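/- Let V be a finite set of n nodes partitioned into two nonempty groups V_a and V_{≠a}, each node v carrying a feature vector x_v ∈ ℝ^d. Let Ã ∈ ℝ^{n×n} be a matrix with nonnegative entries whose rows each sum to 1, and let h_v = Σ_{u∈V} Ã[v,u] x_u. Then the Euclidean norm of the difference of the group mean embeddings satisfies ‖ (1/|V_a|) Σ_{v∈V_a} h_v − (1/|V_{≠a}|) Σ_{v∈V_{≠a}} h_v ‖₂ ≤ |β[a,a] − β[≠a,a]| · ‖μ_a − μ_{≠a}‖₂ + 2√d · δ_a, where β[a,a] = (1/|V_a|) Σ_{i∈V_a, j∈V_a} Ã[i,j], β[≠a,a] = (1/|V_{≠a}|) Σ_{i∈V_{≠a}, j∈V_a} Ã[i,j], μ_a and μ_{≠a} are the means of the feature vectors over V_a and V_{≠a}, and δ_a = max( max_{v∈V_a} ‖x_v − μ_a‖_∞ , max_{v∈V_{≠a}} ‖x_v − μ_{≠a}‖_∞ ). -/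

import Mathlib

open Finset

/-- The Euclidean (ℓ²) norm of a vector in ℝ^d. -/
noncomputable def norm2 {d : ℕ} (v : Fin d → ℝ) : ℝ :=
  Real.sqrt (∑ i, v i ^ 2)

/-- The sup (ℓ^∞) norm of a vector in ℝ^d (the `Pi` norm on `Fin d → ℝ`
is the sup norm). -/
noncomputable def normInf {d : ℕ} (v : Fin d → ℝ) : ℝ := ‖v‖

lemma norm2_eq_aux {d : ℕ} (v : Fin d → ℝ) : norm2 v = ‖(WithLp.toLp 2 v : EuclideanSpace ℝ (Fin d))‖ := by
  rw [EuclideanSpace.norm_eq]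
  simp [norm2]

lemma norm2_add_aux {d : ℕ} (v w : Fin d → ℝ) : norm2 (v + w) ≤ norm2 v + norm2 w := by
  simp only [norm2_eq_aux, WithLp.toLp_add]
  exact norm_add_le _ _

lemma norm2_smul_aux {d : ℕ} (c : ℝ) (v : Fin d → ℝ) : norm2 (c • v) = |c| * norm2 v := by
  simp only [norm2_eq_aux, WithLp.toLp_smul, norm_smul, Real.norm_eq_abs]

lemma norm2_le_aux {d : ℕ} (v : Fin d → ℝ) (c : ℝ) (hc : ‖v‖ ≤ c) :
    norm2 v ≤ Real.sqrt d * c := by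
  have hc0 : 0 ≤ c := (norm_nonneg _).trans hc
  unfold norm2
  rw [Real.sqrt_le_left (by positivity), mul_pow, Real.sq_sqrt (by positivity)]
  have : ∀ i ∈ (Finset.univ : Finset (Fin d)), v i ^ 2 ≤ c ^ 2 := fun i _ => by
    have h1 := (norm_le_pi_norm v i).trans hc
    rw [Real.norm_eq_abs] at h1
    exact sq_le_sq' (by linarith [(abs_le.1 h1).1]) (abs_le.1 h1).2
  simpa using Finset.sum_le_sum this

lemma node_aux {n d : ℕ} (x : Fin n → Fin d → ℝ) (S : Finset (Fin n))
    (a : Fin n → ℝ) (ha0 : ∀ j, 0 ≤ a j) (ha1 : ∑ j, a j = 1)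
    (p q : Fin d → ℝ) (δ : ℝ) (hp : ∀ v ∈ S, ‖x v - p‖ ≤ δ) (hq : ∀ v ∈ Sᶜ, ‖x v - q‖ ≤ δ) :
    ‖∑ u, a u • x u - (q + (∑ j ∈ S, a j) • (p - q))‖ ≤ δ := by
  have e : ∑ u, a u • x u - (q + (∑ j ∈ S, a j) • (p - q))
      = ∑ u, a u • (x u - if u ∈ S then p else q) := by
    have h1 : ∑ u, a u • (if u ∈ S then p else q) = q + (∑ j ∈ S, a j) • (p - q) := by
      have : ∀ u, a u • (if u ∈ S then p else q)
          = a u • q + if u ∈ S then a u • (p - q) else 0 := fun u => by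
        split_ifs
        · rw [← smul_add]; simp
        · simp
      simp only [this, Finset.sum_add_distrib, ← Finset.sum_smul, ha1, one_smul,
        Finset.sum_ite_mem, Finset.univ_inter]
    simp only [smul_sub, Finset.sum_sub_distrib, h1]
  rw [e]
  calc _ ≤ ∑ u, a u * δ := by
        refine norm_sum_le_of_le _ fun u _ => ?_
        rw [norm_smul, Real.norm_of_nonneg (ha0 u)]
        refine mul_le_mul_of_nonneg_left ?_ (ha0 u)
        split_ifs with hu
        · exact hp u hu
        · exact hq u (by simpa using hu)
    _ = δ := by rw [← Finset.sum_mul, ha1, one_mul]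

lemma mean_aux {n d : ℕ} (T : Finset (Fin n)) (hT : T.Nonempty) (h : Fin n → Fin d → ℝ)
    (r : Fin n → ℝ) (q w : Fin d → ℝ) (δ : ℝ) (hv : ∀ v, ‖h v - (q + r v • w)‖ ≤ δ) :
    ‖(T.card : ℝ)⁻¹ • ∑ v ∈ T, h v - (q + ((T.card : ℝ)⁻¹ * ∑ v ∈ T, r v) • w)‖ ≤ δ := by
  have hc : (0 : ℝ) < T.card := by exact_mod_cast hT.card_pos
  have e : (T.card : ℝ)⁻¹ • ∑ v ∈ T, h v - (q + ((T.card : ℝ)⁻¹ * ∑ v ∈ T, r v) • w)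
      = (T.card : ℝ)⁻¹ • ∑ v ∈ T, (h v - (q + r v • w)) := by
    rw [Finset.sum_sub_distrib, Finset.sum_add_distrib, ← Finset.sum_smul, Finset.sum_const,
      smul_sub, smul_add, mul_smul, ← Nat.cast_smul_eq_nsmul ℝ, inv_smul_smul₀ hc.ne']
  rw [e, norm_smul, Real.norm_of_nonneg (by positivity), inv_mul_le_iff₀ hc]
  refine (norm_sum_le_of_le _ fun v _ => hv v).trans ?_
  simp

/-- Intermediate claim in the proof of Theorem 1 of FairSample: the Euclidean disparity
of mean SGCN embeddings across a sensitive group and its complement is bounded by the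
graph structure bias times the attribute bias, plus `2√d·δ`. -/
theorem stmt6 (n d : ℕ) (x : Fin n → Fin d → ℝ)
    (S : Finset (Fin n)) (hS : S.Nonempty) (hSc : Sᶜ.Nonempty)
    (A : Matrix (Fin n) (Fin n) ℝ)
    (hA0 : ∀ i j, 0 ≤ A i j) (hA1 : ∀ i, ∑ j, A i j = 1)
    (h : Fin n → Fin d → ℝ) (hh : ∀ v, h v = ∑ u, A v u • x u)
    (μa μc : Fin d → ℝ)
    (hμa : μa = (S.card : ℝ)⁻¹ • ∑ v ∈ S, x v)
    (hμc : μc = (Sᶜ.card : ℝ)⁻¹ • ∑ v ∈ Sᶜ, x v)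
    (βaa βca : ℝ)
    (hβaa : βaa = (S.card : ℝ)⁻¹ * ∑ i ∈ S, ∑ j ∈ S, A i j)
    (hβca : βca = (Sᶜ.card : ℝ)⁻¹ * ∑ i ∈ Sᶜ, ∑ j ∈ S, A i j)
    (δ : ℝ)
    (hδ : δ = max (S.sup' hS fun v => normInf (x v - μa))
                  (Sᶜ.sup' hSc fun v => normInf (x v - μc))) :
    norm2 ((S.card : ℝ)⁻¹ • ∑ v ∈ S, h v - (Sᶜ.card : ℝ)⁻¹ • ∑ v ∈ Sᶜ, h v)
      ≤ |βaa - βca| * norm2 (μa - μc) + 2 * Real.sqrt d * δ := by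
  have hp : ∀ v ∈ S, ‖x v - μa‖ ≤ δ := fun v hv => by
    rw [hδ]
    exact le_max_of_le_left (Finset.le_sup' (fun v => normInf (x v - μa)) hv)
  have hq : ∀ v ∈ Sᶜ, ‖x v - μc‖ ≤ δ := fun v hv => by
    rw [hδ]
    exact le_max_of_le_right (Finset.le_sup' (fun v => normInf (x v - μc)) hv)
  have hv : ∀ v, ‖h v - (μc + (∑ j ∈ S, A v j) • (μa - μc))‖ ≤ δ := fun v => by
    rw [hh]
    exact node_aux x S (A v) (hA0 v) (hA1 v) μa μc δ hp hq
  have h1 := mean_aux S hS h _ _ _ δ hv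
  have h2 := mean_aux Sᶜ hSc h _ _ _ δ hv
  rw [← hβaa] at h1
  rw [← hβca] at h2
  have h3 := norm2_le_aux _ _ ((norm_sub_le _ _).trans (add_le_add h1 h2))
  have h4 := norm2_add_aux ((βaa - βca) • (μa - μc)) _ |>.trans (add_le_add_right h3 _)
  rw [norm2_smul_aux] at h4
  refine le_trans (le_of_eq ?_) (h4.trans (le_of_eq (by ring)))
  congr 1
  module
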